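/- Let G ∈ 𝒢_n^k (k ≥ 2) be such that every connected component of G minus its cut edges is a complete graph, and suppose one such component K contains two distinct vertices u and u', each incident to at least one cut edge of G. Let Z be the set of endpoints outside K of the cut edges incident to u', and let G* be the graph obtained from G by deleting all edges u'z (z ∈ Z) and adding all edges uz (z ∈ Z). Then G* ∈ 𝒢_n^k, S_i(G) = S_i(G*) for i = 0, 1, 2, 3, and S_4(G) < S_4(G*); in particular G ≺_s G*. (Quantitatively, S_4(G) − S_4(G*) = −4sl, where s ≥ 1 and l ≥ 1 are the numbers of cut edges of G incident to u and to u', respectively.) -/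

import Mathlib

open SimpleGraph

/-- The `k`-th spectral moment of a graph: the trace of the `k`-th power of its
adjacency matrix. -/
noncomputable def specMoment {V : Type*} [Fintype V] (G : SimpleGraph V) (k : ℕ) : ℝ :=
  letI := Classical.decEq V
  letI : DecidableRel G.Adj := Classical.decRel _
  Matrix.trace ((G.adjMatrix ℝ) ^ k)

/-- The strict lexicographic order by spectral moments (`S`-order) for graphs on
`n` vertices. -/
def SLt {V W : Type*} [Fintype V] [Fintype W] (n : ℕ)
    (G : SimpleGraph V) (H : SimpleGraph W) : Prop :=
  ∃ k, 1 ≤ k ∧ k ≤ n - 1 ∧ (∀ i, i < k → specMoment G i = specMoment H i) ∧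
    specMoment G k < specMoment H k

/-- The number of cut edges (bridges) of a graph. -/
noncomputable def numBridges {V : Type*} (G : SimpleGraph V) : ℕ :=
  {e : Sym2 V | G.IsBridge e}.ncard

section AuxTrace
open Matrix
theorem aux_trace {n : ℕ} (B : Matrix (Fin n) (Fin n) ℝ) (hB : Bᵀ = B) (v z : Fin n → ℝ) (l : ℝ)
    (hvv : v ⬝ᵥ v = 1) (hzz : z ⬝ᵥ z = l) (hvz : v ⬝ᵥ z = 0)
    (h1 : v ⬝ᵥ (B *ᵥ z) = 0) (h2 : v ⬝ᵥ ((B * B) *ᵥ z) = 0) (h3 : v ⬝ᵥ ((B * B * B) *ᵥ z) = 0)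
    (hv : v ⬝ᵥ (B *ᵥ v) = 0) (hz : z ⬝ᵥ (B *ᵥ z) = 0) :
    trace ((B + (vecMulVec v z + vecMulVec z v)) ^ 1) = trace B ∧
    trace ((B + (vecMulVec v z + vecMulVec z v)) ^ 2) = trace (B * B) + 2 * l ∧
    trace ((B + (vecMulVec v z + vecMulVec z v)) ^ 3) = trace (B * B * B) ∧
    trace ((B + (vecMulVec v z + vecMulVec z v)) ^ 4) = trace (B * B * B * B)
      + 4 * (l * (v ⬝ᵥ ((B * B) *ᵥ v)) + z ⬝ᵥ ((B * B) *ᵥ z)) + 2 * l ^ 2 := by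
  have hzv : z ⬝ᵥ v = 0 := by rw [dotProduct_comm]; exact hvz
  have sy : ∀ M : Matrix (Fin n) (Fin n) ℝ, Mᵀ = M → z ⬝ᵥ (M *ᵥ v) = v ⬝ᵥ (M *ᵥ z) := by
    intro M hM
    rw [dotProduct_mulVec, ← mulVec_transpose, hM, dotProduct_comm]
  have h1' : z ⬝ᵥ (B *ᵥ v) = 0 := by rw [sy _ hB, h1]
  have h2' : z ⬝ᵥ ((B * B) *ᵥ v) = 0 := by rw [sy _ (by simp [hB]), h2]
  have h3' : z ⬝ᵥ ((B * B * B) *ᵥ v) = 0 := by rw [sy _ (by simp [hB, mul_assoc]), h3]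
  set P := vecMulVec v z + vecMulVec z v with hP
  have tv : ∀ (M : Matrix (Fin n) (Fin n) ℝ) (a b : Fin n → ℝ),
      trace (M * vecMulVec a b) = b ⬝ᵥ (M *ᵥ a) := by
    intro M a b
    rw [mul_vecMulVec, trace_vecMulVec, dotProduct_comm]
  have hPP : P * P = l • vecMulVec v v + vecMulVec z z := by
    simp [hP, mul_add, add_mul, vecMulVec_mul_vecMulVec, hvv, hzz, hvz, hzv, vecMulVec_smul]
    abel
  have hPPP : P * P * P = l • P := by
    rw [hPP]
    simp [hP, mul_add, add_mul, vecMulVec_mul_vecMulVec, hvv, hzz, hvz, hzv, vecMulVec_smul]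
  have tP : ∀ M : Matrix (Fin n) (Fin n) ℝ, trace (M * P) = z ⬝ᵥ (M *ᵥ v) + v ⬝ᵥ (M *ᵥ z) := by
    intro M; simp [hP, mul_add, tv]
  have tPP : ∀ M : Matrix (Fin n) (Fin n) ℝ,
      trace (M * (P * P)) = l * (v ⬝ᵥ (M *ᵥ v)) + z ⬝ᵥ (M *ᵥ z) := by
    intro M; simp [hPP, mul_add, tv]
  have t0 : trace P = 0 := by simp [hP, hvz, hzv]
  have t1 : trace (P * P) = 2 * l := by simp [hPP, hvv, hzz]; ring
  have t2 : trace (P * P * P) = 0 := by simp [hPPP, t0]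
  have t3 : trace (P * P * P * P) = 2 * l ^ 2 := by simp [hPPP, t1]; ring
  have b1 : trace (B * P) = 0 := by rw [tP, h1, h1']; simp
  have b2 : trace (B * B * P) = 0 := by rw [tP, h2, h2']; simp
  have b3 : trace (B * B * B * P) = 0 := by rw [tP, h3, h3']; simp
  have c1 : trace (B * (P * P)) = 0 := by rw [tPP, hv, hz]; simp
  have c2 := tPP (B * B)
  have d1 : trace (B * (P * P * P)) = 0 := by rw [hPPP]; simp [b1]
  have d2 : trace (B * P * B * P) = 0 := by
    rw [tP, hP]
    simp only [mul_add, add_mul, mul_vecMulVec, vecMulVec_mul, add_mulVec, vecMulVec_mulVec,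
      dotProduct_add]
    simp [h1, h1', hv, hz, ← dotProduct_mulVec]
  refine ⟨by simp [t0], ?_, ?_, ?_⟩
  · have e : (B + P) ^ 2 = B * B + B * P + P * B + P * P := by noncomm_ring
    rw [e]; simp only [trace_add]
    linarith [trace_mul_comm B P]
  · have e : (B + P) ^ 3 = B * B * B + (B * B * P + B * (P * B) + P * (B * B)) +
      (B * (P * P) + (P * B) * P + (P * P) * B) + P * P * P := by noncomm_ring
    rw [e]; simp only [trace_add]
    have := trace_mul_comm P (B * B)
    have := trace_mul_comm B (P * B)
    have e1 : P * B * B = P * (B * B) := by noncomm_ring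
    have := trace_mul_comm (P * P) B
    have := trace_mul_comm (P * B) P
    have e2 : P * (P * B) = P * P * B := by noncomm_ring
    simp_all
  · have e : (B + P) ^ 4 = B * B * B * B +
      (B * B * B * P + (B * B) * (P * B) + B * (P * (B * B)) + P * (B * B * B)) +
      (B * B * (P * P) + B * ((P * P) * B) + (P * P) * (B * B) + P * (B * B * P) +
        B * P * B * P + P * (B * P * B)) +
      (B * (P * P * P) + P * (B * (P * P)) + (P * P) * (B * P) + (P * P * P) * B)
        + P * P * P * P := by noncomm_ring
    have a1 : trace ((B * B) * (P * B)) = trace (B * B * B * P) := by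
      rw [trace_mul_comm, mul_assoc, trace_mul_comm]; congr 1; noncomm_ring
    have a2 : trace (B * (P * (B * B))) = trace (B * B * B * P) := by
      rw [trace_mul_comm, mul_assoc, trace_mul_comm]
    have a3 : trace (P * (B * B * B)) = trace (B * B * B * P) := trace_mul_comm _ _
    have a4 : trace (B * ((P * P) * B)) = trace (B * B * (P * P)) := by
      rw [trace_mul_comm, mul_assoc, trace_mul_comm]
    have a5 : trace ((P * P) * (B * B)) = trace (B * B * (P * P)) := trace_mul_comm _ _
    have a6 : trace (P * (B * B * P)) = trace (B * B * (P * P)) := by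
      rw [trace_mul_comm]; congr 1; noncomm_ring
    have a7 : trace (P * (B * P * B)) = trace (B * P * B * P) := trace_mul_comm _ _
    have a8 : trace (P * (B * (P * P))) = trace (B * (P * P * P)) := by
      rw [trace_mul_comm]; congr 1; noncomm_ring
    have a9 : trace ((P * P) * (B * P)) = trace (B * (P * P * P)) := by
      rw [trace_mul_comm]; congr 1; noncomm_ring
    have a10 : trace ((P * P * P) * B) = trace (B * (P * P * P)) := trace_mul_comm _ _
    rw [e]; simp only [trace_add]
    rw [a1, a2, a3, a4, a5, a6, a7, a8, a9, a10, b3, c2, d1, d2, t3]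
    ring

end AuxTrace

/-- The star with centre `x` and leaves `Z`. -/
def auxStar {V : Type*} (x : V) (Z : Set V) : SimpleGraph V :=
  SimpleGraph.fromEdgeSet {e | ∃ z ∈ Z, e = s(x, z)}

theorem auxStar_adj {V : Type*} (x : V) (Z : Set V) (a b : V) :
    (auxStar x Z).Adj a b ↔ ((a = x ∧ b ∈ Z) ∨ (b = x ∧ a ∈ Z)) ∧ a ≠ b := by
  simp only [auxStar, fromEdgeSet_adj, Set.mem_ofPred_eq, Sym2.eq_iff]
  constructor
  · rintro ⟨⟨z, hz, (⟨rfl, rfl⟩ | ⟨rfl, rfl⟩)⟩, h⟩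
    · exact ⟨Or.inl ⟨rfl, hz⟩, h⟩
    · exact ⟨Or.inr ⟨rfl, hz⟩, h⟩
  · rintro ⟨(⟨rfl, hz⟩ | ⟨rfl, hz⟩), h⟩
    · exact ⟨⟨b, hz, Or.inl ⟨rfl, rfl⟩⟩, h⟩
    · exact ⟨⟨a, hz, Or.inr ⟨rfl, rfl⟩⟩, h⟩

theorem reach_of_adj {V : Type*} {M N : SimpleGraph V}
    (h : ∀ a b, M.Adj a b → N.Reachable a b) {x y : V} (hr : M.Reachable x y) :
    N.Reachable x y := by
  obtain ⟨p⟩ := hr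
  induction p with
  | nil => exact Reachable.refl _
  | cons hadj _ ih => exact (h _ _ hadj).trans ih

theorem star_reach {V : Type*} (M : SimpleGraph V) (Z : Set V) {u u' : V}
    (huu : M.Reachable u u') {x y : V} (h : (M ⊔ auxStar u Z).Reachable x y) :
    (M ⊔ auxStar u' Z).Reachable x y := by
  have huu2 : (M ⊔ auxStar u' Z).Reachable u u' := huu.mono le_sup_left
  have key : ∀ z ∈ Z, (M ⊔ auxStar u' Z).Reachable u z := by
    intro z hz
    by_cases hzu : u' = z
    · exact hzu ▸ huu2
    · refine huu2.trans (Adj.reachable ?_)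
      rw [sup_adj, auxStar_adj]
      exact Or.inr ⟨Or.inl ⟨rfl, hz⟩, hzu⟩
  refine reach_of_adj ?_ h
  intro a b hab
  rw [sup_adj, auxStar_adj] at hab
  rcases hab with hab | ⟨(⟨rfl, hz⟩ | ⟨rfl, hz⟩), -⟩
  · exact (Adj.reachable hab).mono le_sup_left
  · exact key _ hz
  · exact (key _ hz).symm

/-- A non-bridge edge stays a non-bridge after deleting all bridges. -/
theorem nonbridge_reach {V : Type*} (G : SimpleGraph V) {u u' : V}
    (h : (G.deleteEdges {e | G.IsBridge e}).Adj u u') :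
    ((G.deleteEdges {e | G.IsBridge e}).deleteEdges {s(u, u')}).Reachable u u' := by
  by_contra hcon
  rw [← isBridge_iff, isBridge_iff_forall_cycle_notMem h] at hcon
  rw [deleteEdges_adj] at h
  obtain ⟨hG, hnb⟩ := h
  apply hnb
  show G.IsBridge s(u, u')
  rw [isBridge_iff_forall_cycle_notMem (G.mem_edgeSet.2 hG)]
  intro w p hp hmem
  have hq : ∀ e ∈ p.edges, e ∈ (G.deleteEdges {e | G.IsBridge e}).edgeSet := by
    intro e he
    rw [edgeSet_deleteEdges]
    exact ⟨p.edges_subset_edgeSet he, fun hb => IsBridge.notMem_edges_of_isCycle hb hp he⟩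
  exact hcon (p.transfer _ hq) (hp.transfer hq) (by simpa using hmem)

theorem adj_pow_zero {n : ℕ} (H : SimpleGraph (Fin n)) [DecidableRel H.Adj] (j : ℕ) (x y : Fin n)
    (h : ¬ H.Reachable x y) : (H.adjMatrix ℝ ^ j) x y = 0 := by
  rw [adjMatrix_pow_apply_eq_card_walk]
  simp only [Nat.cast_eq_zero, Fintype.card_eq_zero_iff]
  exact ⟨fun p => h ⟨p.1⟩⟩

open Matrix in
/-- Spectral moments of a graph with a star glued on. -/
theorem moments_star {n : ℕ} (H : SimpleGraph (Fin n)) (x : Fin n) (Z : Set (Fin n))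
    (hr : ∀ z ∈ Z, ¬ H.Reachable x z) (hZ : ∀ a ∈ Z, ∀ b ∈ Z, ¬ H.Adj a b) :
    specMoment (H ⊔ auxStar x Z) 0 = n ∧
    specMoment (H ⊔ auxStar x Z) 1 = specMoment H 1 ∧
    specMoment (H ⊔ auxStar x Z) 2 = specMoment H 2 + 2 * Z.ncard ∧
    specMoment (H ⊔ auxStar x Z) 3 = specMoment H 3 ∧
    ∃ c : ℝ, specMoment (H ⊔ auxStar x Z) 4 = specMoment H 4 + 4 * 
        (Z.ncard * {y | H.Adj x y}.ncard + c) + 2 * (Z.ncard : ℝ) ^ 2 ∧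
      c = (letI : DecidableRel H.Adj := Classical.decRel _
        Z.indicator (fun _ => (1 : ℝ)) ⬝ᵥ ((H.adjMatrix ℝ * H.adjMatrix ℝ) *ᵥ
          Z.indicator (fun _ => (1 : ℝ)))) := by
  classical
  letI d1 : DecidableRel H.Adj := Classical.decRel _
  letI d2 : DecidableRel (H ⊔ auxStar x Z).Adj := Classical.decRel _
  have hxZ : x ∉ Z := fun h => hr x h (Reachable.refl _)
  set B := H.adjMatrix ℝ with hBdef
  set z : Fin n → ℝ := Z.indicator (fun _ => (1 : ℝ)) with hz
  set v : Fin n → ℝ := Pi.single x 1 with hv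
  have hA : (H ⊔ auxStar x Z).adjMatrix ℝ = B + (vecMulVec v z + vecMulVec z v) := by
    ext a b
    have hHs : ∀ w ∈ Z, ¬ H.Adj x w := fun w hw h => hr w hw h.reachable
    have hHs' : ∀ w ∈ Z, ¬ H.Adj w x := fun w hw h => hr w hw h.symm.reachable
    simp only [adjMatrix_apply, hBdef, Matrix.add_apply, vecMulVec_apply, sup_adj, auxStar_adj,
      hz, hv, Set.indicator_apply, Pi.single_apply]
    by_cases ha : a = x
    · subst ha
      by_cases hb : b ∈ Z
      · have : a ≠ b := fun h => hxZ (h ▸ hb)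
        simp [hb, hHs b hb, hxZ, this]
      · simp [hb, hxZ]
    · by_cases hb : b = x
      · subst hb
        by_cases haZ : a ∈ Z
        · simp [haZ, ha, hHs' a haZ]
        · simp [haZ, ha]
      · simp [ha, hb]
  have vd : ∀ w : Fin n → ℝ, v ⬝ᵥ w = w x := by intro w; simp [hv]
  have zero : ∀ j, v ⬝ᵥ ((B ^ j) *ᵥ z) = 0 := by
    intro j
    rw [vd]
    simp only [mulVec, dotProduct, hz, Set.indicator_apply]
    refine Finset.sum_eq_zero fun y _ => ?_
    by_cases hy : y ∈ Z
    · simp [hBdef, adj_pow_zero H j x y (hr y hy)]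
    · simp [hy]
  have hzz : z ⬝ᵥ z = Z.ncard := by
    have e1 : ∀ y, z y * z y = if y ∈ Z then (1 : ℝ) else 0 := by
      intro y
      by_cases hy : y ∈ Z <;> simp [hz, hy]
    simp only [dotProduct, e1]
    rw [Finset.sum_boole, Set.ncard_eq_toFinset_card']
    congr 2
    ext y
    simp
  have hzBz : z ⬝ᵥ (B *ᵥ z) = 0 := by
    simp only [dotProduct, mulVec, hz, Set.indicator_apply, hBdef, adjMatrix_apply]
    refine Finset.sum_eq_zero fun a _ => ?_
    by_cases ha : a ∈ Z
    · simp only [ha, if_true, one_mul]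
      refine Finset.sum_eq_zero fun b _ => ?_
      by_cases hb : b ∈ Z
      · simp [hZ a ha b hb]
      · simp [hb]
    · simp [ha]
  have hdeg : v ⬝ᵥ ((B * B) *ᵥ v) = {y | H.Adj x y}.ncard := by
    rw [vd]
    have : ((B * B) *ᵥ v) x = (B * B) x x := by simp [hv]
    rw [this, hBdef, adjMatrix_mul_self_apply_self]
    congr 1
    rw [← card_neighborFinset_eq_degree, Set.ncard_eq_toFinset_card']
    apply congrArg Finset.card
    ext y
    simp
  have main := aux_trace B (by simp [hBdef]) v z Z.ncard (by simp [hv]) hzz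
    (by rw [vd]; simp [hz, hxZ]) (by simpa using zero 1) (by simpa [pow_two] using zero 2)
    (by simpa [pow_succ] using zero 3) (by rw [vd]; simp [hv, hBdef]) hzBz
  have sm : ∀ i, specMoment (H ⊔ auxStar x Z) i = trace ((B + (vecMulVec v z + vecMulVec z v)) ^ i) := by
    intro i
    rw [← hA]
    unfold specMoment
    congr!
  have sH : ∀ i, specMoment H i = trace (B ^ i) := by
    intro i
    unfold specMoment
    congr!
  obtain ⟨m1, m2, m3, m4⟩ := main
  refine ⟨by rw [sm]; simp, by rw [sm, m1, sH]; simp, by rw [sm, m2, sH, pow_two],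
    by rw [sm, m3, sH]; simp [pow_succ], _, ?_, rfl⟩
  rw [sm, m4, sH, hdeg]; simp [pow_succ]

theorem bridge_star {n : ℕ} (H : SimpleGraph (Fin n)) (u u' : Fin n) (Z : Set (Fin n))
    (hre : ∀ f : Sym2 (Fin n), (H.deleteEdges {f}).Reachable u u')
    (hrz : ∀ z ∈ Z, ¬ H.Reachable u z)
    (f : Sym2 (Fin n)) (hf : f ∈ H.edgeSet) (hb : (H ⊔ auxStar u Z).IsBridge f) :
    (H ⊔ auxStar u' Z).IsBridge f := by
  induction f with | h a b => ?_
  have hd : ∀ x : Fin n, (∀ z ∈ Z, ¬ H.Reachable x z) → 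
      (H ⊔ auxStar x Z).deleteEdges {s(a, b)} = H.deleteEdges {s(a, b)} ⊔ auxStar x Z := by
    intro x hx
    ext c d
    simp only [deleteEdges_adj, sup_adj, auxStar_adj, Set.mem_singleton_iff]
    constructor
    · tauto
    · rintro (h | h)
      · tauto
      · refine ⟨Or.inr h, fun he => ?_⟩
        have hcd : H.Adj c d := by
          rw [← mem_edgeSet, he]; exact hf
        rcases h.1 with ⟨rfl, hz⟩ | ⟨rfl, hz⟩
        · exact hx _ hz hcd.reachable
        · exact hx _ hz hcd.symm.reachable
  have huu : H.Reachable u u' := (hre s(a, b)).mono (deleteEdges_le _)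
  rw [isBridge_iff, hd u hrz] at hb
  rw [isBridge_iff, hd u' (fun z hz h => hrz z hz (huu.trans h))]
  intro h
  exact hb (star_reach _ Z (hre _).symm h)

theorem bridges_split {n : ℕ} (H : SimpleGraph (Fin n)) (u : Fin n) (Z : Set (Fin n))
    (hconn : (H ⊔ auxStar u Z).Connected)
    (hrz : ∀ z ∈ Z, ¬ H.Reachable u z)
    (hs : ∀ z ∈ Z, (H ⊔ auxStar u Z).IsBridge s(u, z)) :
    numBridges (H ⊔ auxStar u Z) =
      {f | f ∈ H.edgeSet ∧ (H ⊔ auxStar u Z).IsBridge f}.ncard + Z.ncard := by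
  have himg : Z.ncard = ((fun z => s(u, z)) '' Z).ncard := by
    rw [Set.ncard_image_of_injective]
    intro a b h
    simp only [Sym2.eq_iff] at h
    grind
  rw [himg, ← Set.ncard_union_eq]
  · unfold numBridges
    congr 1
    ext f
    induction f with | h a b => ?_
    simp only [Set.mem_ofPred_eq, Set.mem_union, Set.mem_image]
    constructor
    · intro hb
      have hadj := hb.reachable_iff_adj.1 (hconn.preconnected a b)
      rw [sup_adj, auxStar_adj] at hadj
      rcases hadj with h | ⟨(⟨rfl, hz⟩ | ⟨rfl, hz⟩), -⟩
      · exact Or.inl ⟨h, hb⟩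
      · exact Or.inr ⟨_, hz, rfl⟩
      · exact Or.inr ⟨_, hz, Sym2.eq_swap⟩
    · rintro (h | ⟨z, hz, h⟩)
      · exact h.2
      · rw [← h]; exact hs z hz
  · rw [Set.disjoint_left]
    rintro f ⟨hf, -⟩ ⟨z, hz, rfl⟩
    exact hrz z hz (Adj.reachable hf)

/-- Let `G` be a connected `n`-vertex graph with `k ≥ 2` cut edges such that each
connected component of `G` minus its cut edges is a complete graph, and suppose
one such component contains two distinct vertices `u, u'`, each incident to at
least one cut edge of `G`.  Let `Z` be the set of endpoints (outside that
component) of the cut edges incident to `u'`, and let `G*` be obtained from `G`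
by deleting all edges `u'z` (`z ∈ Z`) and adding all edges `uz` (`z ∈ Z`).
Then `G*` is a connected `n`-vertex graph with `k` cut edges,
`S_i(G) = S_i(G*)` for `i = 0, 1, 2, 3`, `S_4(G) < S_4(G*)`, quantitatively
`S_4(G) - S_4(G*) = -4sl` where `s` and `l` are the numbers of cut edges of `G`
incident to `u` and to `u'` respectively, and in particular `G ≺_s G*`. -/
theorem shift_cut_edges_S_lt (n k : ℕ) (hk : 2 ≤ k) (G : SimpleGraph (Fin n))
    (hconn : G.Connected) (hbr : numBridges G = k)
    (hcomplete : ∀ x y : Fin n, x ≠ y →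
      (G.deleteEdges {e | G.IsBridge e}).Reachable x y →
      (G.deleteEdges {e | G.IsBridge e}).Adj x y)
    (u u' : Fin n) (huu' : u ≠ u')
    (hsame : (G.deleteEdges {e | G.IsBridge e}).Reachable u u')
    (hu : ∃ z, G.IsBridge s(u, z)) (hu' : ∃ z, G.IsBridge s(u', z))
    (Z : Set (Fin n)) (hZ : Z = {z : Fin n | G.IsBridge s(u', z)})
    (Gstar : SimpleGraph (Fin n))
    (hGstar : Gstar = (G.deleteEdges {e | ∃ z ∈ Z, e = s(u', z)}) ⊔
      SimpleGraph.fromEdgeSet {e | ∃ z ∈ Z, e = s(u, z)}) :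
    Gstar.Connected ∧ numBridges Gstar = k ∧
    (∀ i, i ≤ 3 → specMoment G i = specMoment Gstar i) ∧
    specMoment G 4 < specMoment Gstar 4 ∧
    specMoment G 4 - specMoment Gstar 4 =
      -(4 * (({z : Fin n | G.IsBridge s(u, z)}.ncard : ℝ)) * ((Z.ncard : ℝ))) ∧
    SLt n G Gstar := by
  classical
  set D := G.deleteEdges {e | G.IsBridge e} with hD
  set H := G.deleteEdges {e | ∃ z ∈ Z, e = s(u', z)} with hH
  have hGs : Gstar = H ⊔ auxStar u Z := hGstar
  have memZ : ∀ z, z ∈ Z ↔ G.IsBridge s(u', z) := by intro z; rw [hZ]; rfl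
  have brAdj : ∀ a b, G.IsBridge s(a, b) → G.Adj a b := fun a b h =>
    h.reachable_iff_adj.1 (hconn.preconnected a b)
  have hGeq : G = H ⊔ auxStar u' Z := by
    ext a b
    simp only [sup_adj, auxStar_adj, hH, deleteEdges_adj, Set.mem_ofPred_eq]
    constructor
    · intro h
      by_cases hc : ∃ z ∈ Z, s(a, b) = s(u', z)
      · obtain ⟨z, hz, he⟩ := hc
        rw [Sym2.eq_iff] at he
        rcases he with ⟨rfl, rfl⟩ | ⟨rfl, rfl⟩
        · exact Or.inr ⟨Or.inl ⟨rfl, hz⟩, h.ne⟩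
        · exact Or.inr ⟨Or.inr ⟨rfl, hz⟩, h.ne⟩
      · exact Or.inl ⟨h, hc⟩
    · rintro (h | ⟨(⟨rfl, hz⟩ | ⟨rfl, hz⟩), -⟩)
      · exact h.1
      · exact brAdj _ _ ((memZ _).1 hz)
      · exact (brAdj _ _ ((memZ _).1 hz)).symm
  have hDH : D ≤ H := by
    intro a b h
    rw [hD, deleteEdges_adj] at h
    rw [hH, deleteEdges_adj]
    refine ⟨h.1, ?_⟩
    rintro ⟨z, hz, he⟩
    exact h.2 (by rw [he]; exact (memZ z).1 hz)
  have hDuu : D.Adj u u' := hcomplete u u' huu' hsame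
  have hD2 : (D.deleteEdges {s(u, u')}).Reachable u u' := nonbridge_reach G hDuu
  have hre : ∀ f : Sym2 (Fin n), (H.deleteEdges {f}).Reachable u u' := by
    intro f
    by_cases hf : f = s(u, u')
    · rw [hf]; exact hD2.mono (deleteEdges_mono hDH)
    · apply Adj.reachable
      rw [deleteEdges_adj]
      exact ⟨hDH hDuu, fun h => hf (Set.mem_singleton_iff.1 h).symm⟩
  have hHuu : H.Reachable u u' := (hDH hDuu).reachable
  have hrz' : ∀ z ∈ Z, ¬ H.Reachable u' z := by
    intro z hz h
    have hb := (memZ z).1 hz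
    rw [isBridge_iff] at hb
    refine hb (h.mono ?_)
    rw [hH]
    apply deleteEdges_anti
    rintro e rfl
    exact ⟨z, hz, rfl⟩
  have hrz : ∀ z ∈ Z, ¬ H.Reachable u z := fun z hz h => hrz' z hz (hHuu.symm.trans h)
  have hZind : ∀ a ∈ Z, ∀ b ∈ Z, ¬ H.Adj a b := by
    intro a ha b hb h
    have hba := (memZ a).1 ha
    have hab : a ≠ b := h.ne
    have hua : u' ≠ a := (brAdj _ _ hba).ne
    have hub : u' ≠ b := (brAdj _ _ ((memZ b).1 hb)).ne
    rw [isBridge_iff] at hba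
    apply hba
    have e1 : (G.deleteEdges {s(u', a)}).Adj u' b := by
      rw [deleteEdges_adj]
      refine ⟨brAdj _ _ ((memZ b).1 hb), ?_⟩
      simp only [Set.mem_singleton_iff, Sym2.eq_iff]
      tauto
    have e2 : (G.deleteEdges {s(u', a)}).Adj b a := by
      rw [deleteEdges_adj]
      refine ⟨(deleteEdges_le _ h).symm, ?_⟩
      simp only [Set.mem_singleton_iff, Sym2.eq_iff]
      tauto
    exact e1.reachable.trans e2.reachable
  have hconn' : Gstar.Connected := by
    haveI := hconn.nonempty
    rw [hGs]
    refine ⟨fun x y => ?_⟩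
    have := hconn.preconnected x y
    rw [hGeq] at this
    exact star_reach H Z hHuu.symm this
  have hs' : ∀ z ∈ Z, (H ⊔ auxStar u' Z).IsBridge s(u', z) := by
    intro z hz
    rw [← hGeq]; exact (memZ z).1 hz
  have hs : ∀ z ∈ Z, (H ⊔ auxStar u Z).IsBridge s(u, z) := by
    intro z hz
    rw [isBridge_iff]
    intro h
    have h1 : (H ⊔ auxStar u (Z \ {z})).Reachable u z := by
      refine h.mono ?_
      intro a b hab
      simp only [deleteEdges_adj, sup_adj, auxStar_adj, Set.mem_singleton_iff, Sym2.eq_iff] at hab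
      simp only [sup_adj, auxStar_adj, Set.mem_sdiff, Set.mem_singleton_iff]
      tauto
    have h2 := star_reach H _ hHuu h1
    have h3 : (H ⊔ auxStar u' (Z \ {z})).Reachable u' z :=
      (hHuu.symm.mono le_sup_left).trans h2
    have h4 := hs' z hz
    rw [isBridge_iff] at h4
    apply h4
    refine h3.mono ?_
    have huz : u' ∉ Z := fun h => hrz' _ h (Reachable.refl _)
    intro a b hab
    simp only [sup_adj, auxStar_adj, Set.mem_sdiff, Set.mem_singleton_iff] at hab
    simp only [deleteEdges_adj, sup_adj, auxStar_adj, Set.mem_singleton_iff, Sym2.eq_iff]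
    have hn1 : ¬ H.Adj u' z := fun h => hrz' z hz h.reachable
    have hn2 : ¬ H.Adj z u' := fun h => hrz' z hz h.symm.reachable
    rcases hab with hab | ⟨(⟨rfl, hb, hne⟩ | ⟨rfl, hb, hne⟩), hab⟩
    · refine ⟨Or.inl hab, ?_⟩
      rintro (⟨rfl, rfl⟩ | ⟨rfl, rfl⟩)
      · exact hn1 hab
      · exact hn2 hab
    · refine ⟨Or.inr ⟨Or.inl ⟨rfl, hb⟩, hab⟩, ?_⟩
      rintro (⟨-, rfl⟩ | ⟨rfl, rfl⟩)
      · exact hne rfl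
      · exact hab rfl
    · refine ⟨Or.inr ⟨Or.inr ⟨rfl, hb⟩, hab⟩, ?_⟩
      rintro (⟨rfl, rfl⟩ | ⟨rfl, -⟩)
      · exact hab rfl
      · exact hne rfl
  have hnb : numBridges Gstar = k := by
    rw [← hbr, hGs, bridges_split H u Z (hGs ▸ hconn') hrz hs]
    conv_rhs => rw [hGeq]
    rw [bridges_split H u' Z (by rw [← hGeq]; exact hconn) hrz' hs']
    congr 2
    ext f
    constructor
    · rintro ⟨h1, h2⟩
      exact ⟨h1, bridge_star H u u' Z hre hrz f h1 h2⟩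
    · rintro ⟨h1, h2⟩
      exact ⟨h1, bridge_star H u' u Z (fun f => (hre f).symm) hrz' f h1 h2⟩
  -- degrees
  have hN' : {y | H.Adj u' y} = {y | D.Adj u' y} := by
    ext y
    simp only [Set.mem_ofPred_eq]
    refine ⟨fun h => ?_, fun h => hDH h⟩
    rw [hD, deleteEdges_adj]
    refine ⟨deleteEdges_le _ h, fun hb => ?_⟩
    exact hrz' y ((memZ y).2 hb) h.reachable
  have hN : {y | H.Adj u y} = {y | D.Adj u y} ∪ {y | G.IsBridge s(u, y)} := by
    ext y
    simp only [Set.mem_ofPred_eq, Set.mem_union]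
    constructor
    · intro h
      by_cases hb : G.IsBridge s(u, y)
      · exact Or.inr hb
      · left
        rw [hD, deleteEdges_adj]
        exact ⟨deleteEdges_le _ h, hb⟩
    · rintro (h | h)
      · exact hDH h
      · rw [hH, deleteEdges_adj]
        refine ⟨brAdj _ _ h, ?_⟩
        rintro ⟨z, hz, he⟩
        rw [Sym2.eq_iff] at he
        rcases he with ⟨h1, h2⟩ | ⟨h1, h2⟩
        · exact huu' h1
        · exact hrz z hz (h1 ▸ Reachable.refl _)
  have hins : insert u {y | D.Adj u y} = insert u' {y | D.Adj u' y} := by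
    have gen : ∀ w, insert w {y | D.Adj w y} = {y | D.Reachable w y} := by
      intro w
      ext y
      simp only [Set.mem_insert_iff, Set.mem_ofPred_eq]
      constructor
      · rintro (rfl | h)
        · exact Reachable.refl _
        · exact h.reachable
      · intro h
        by_cases hy : y = w
        · exact Or.inl hy
        · exact Or.inr (hcomplete w y (Ne.symm hy) h)
    rw [gen, gen]
    ext y
    exact ⟨fun h => hsame.symm.trans h, fun h => hsame.trans h⟩
  have hcardD : {y | D.Adj u y}.ncard = {y | D.Adj u' y}.ncard := by
    have := congrArg Set.ncard hins
    rw [Set.ncard_insert_of_notMem (by simp), Set.ncard_insert_of_notMem (by simp)] at this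
    omega
  have hcard : {y | H.Adj u y}.ncard = {y | H.Adj u' y}.ncard + {y | G.IsBridge s(u, y)}.ncard := by
    rw [hN, hN', ← hcardD, Set.ncard_union_eq]
    rw [Set.disjoint_left]
    intro y hy hb
    simp only [Set.mem_ofPred_eq, hD, deleteEdges_adj] at hy hb
    exact hy.2 hb
  obtain ⟨p0, p1, p2, p3, c, p4, hc⟩ := moments_star H u' Z hrz' hZind
  obtain ⟨q0, q1, q2, q3, c', q4, hc'⟩ := moments_star H u Z hrz hZind
  rw [← hGeq] at p0 p1 p2 p3 p4
  rw [← hGs] at q0 q1 q2 q3 q4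
  have hcc : c = c' := by rw [hc, hc']
  have hlow : ∀ i, i ≤ 3 → specMoment G i = specMoment Gstar i := by
    intro i hi
    interval_cases i
    · rw [p0, q0]
    · rw [p1, q1]
    · rw [p2, q2]
    · rw [p3, q3]
  have hdiff : specMoment G 4 - specMoment Gstar 4 =
      -(4 * (({z : Fin n | G.IsBridge s(u, z)}.ncard : ℝ)) * ((Z.ncard : ℝ))) := by
    rw [p4, q4, hcard, hcc]
    push_cast
    ring
  have hlpos : 0 < Z.ncard := by
    rw [Set.ncard_pos]
    obtain ⟨z, hz⟩ := hu'
    exact ⟨z, (memZ z).2 hz⟩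
  have hspos : 0 < {z : Fin n | G.IsBridge s(u, z)}.ncard := by
    rw [Set.ncard_pos]; exact hu
  have hlt : specMoment G 4 < specMoment Gstar 4 := by
    have h1 : (0 : ℝ) < Z.ncard := by exact_mod_cast hlpos
    have h2 : (0 : ℝ) < {z : Fin n | G.IsBridge s(u, z)}.ncard := by exact_mod_cast hspos
    have := mul_pos h2 h1
    nlinarith
  have hn5 : 5 ≤ n := by
    obtain ⟨w, hw⟩ : ∃ w, (D.deleteEdges {s(u, u')}).Adj u w := by
      obtain ⟨p⟩ := hD2
      cases p with
      | nil => exact absurd rfl huu'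
      | cons h _ => exact ⟨_, h⟩
    rw [deleteEdges_adj] at hw
    obtain ⟨hw1, hw2⟩ := hw
    have hwu : u ≠ w := hw1.ne
    have hwu' : w ≠ u' := fun h => hw2 (by rw [h]; rfl)
    obtain ⟨a, ha⟩ := hu
    obtain ⟨b, hb⟩ := hu'
    have hbZ := (memZ b).2 hb
    have noD : ∀ y, D.Reachable u y → ¬ G.IsBridge s(u, y) := by
      intro y hy hby
      have := hcomplete u y (brAdj _ _ hby).ne hy
      rw [hD, deleteEdges_adj] at this
      exact this.2 hby
    have b1 : b ≠ u := fun h => hrz b hbZ (h ▸ Reachable.refl _)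
    have b2 : b ≠ u' := fun h => hrz' b hbZ (h ▸ Reachable.refl _)
    have b3 : b ≠ w := fun h => hrz b hbZ (h ▸ (hDH hw1).reachable)
    have a1 : a ≠ u := fun h => noD a (h ▸ Reachable.refl _) ha
    have a2 : a ≠ u' := fun h => noD a (h ▸ hsame) ha
    have a3 : a ≠ w := fun h => noD a (h ▸ hw1.reachable) ha
    have hHa : H.Adj u a := by
      have : a ∈ {y | H.Adj u y} := by rw [hN]; exact Or.inr ha
      exact this
    have hab : a ≠ b := fun h => hrz b hbZ (h ▸ hHa.reachable)
    have hc5 : ({u, u', w, a, b} : Finset (Fin n)).card = 5 := by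
      rw [Finset.card_insert_of_notMem, Finset.card_insert_of_notMem,
        Finset.card_insert_of_notMem, Finset.card_pair hab]
      all_goals simp only [Finset.mem_insert, Finset.mem_singleton]; grind
    have := Finset.card_le_univ ({u, u', w, a, b} : Finset (Fin n))
    rw [hc5, Fintype.card_fin] at this
    exact this
  exact ⟨hconn', hnb, hlow, hlt, hdiff, 4, by norm_num, by omega,
    fun i hi => hlow i (by omega), hlt⟩
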